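/- There exists N such that for all n ≥ N and every p ∈ (0,1], the following holds for G ~ G_{n,p}: with probability at least 1 − 1/n², every pair of disjoint sets A, B ⊆ {1,…,n} with |A| = a and |B| = b satisfies: (i) if (1/a + 1/b)·(log n)/p ≥ 7/2, then e_G(A,B) ≤ (3/2)(a+b)·log n; and (ii) if (1/a + 1/b)·(log n)/p ≤ 7/2, then e_G(A,B) ≤ 6abp. -/

import Mathlib

open scoped Classical
open SimpleGraph

namespace EDHC

/-- Degree of a vertex (as cardinality of its neighbour set). -/
noncomputable def deg {V : Type} (G : SimpleGraph V) (v : V) : ℕ := (G.neighborSet v).ncard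

/-- Minimum degree. -/
noncomputable def minDeg {V : Type} (G : SimpleGraph V) : ℕ := sInf (Set.range (deg G))

/-- Maximum degree. -/
noncomputable def maxDeg {V : Type} (G : SimpleGraph V) : ℕ := sSup (Set.range (deg G))

/-- Number of edges of `G` with both endpoints in `S`. -/
noncomputable def eIn {V : Type} (G : SimpleGraph V) (S : Set V) : ℕ :=
  {e ∈ G.edgeSet | ∀ v ∈ e, v ∈ S}.ncard

/-- Number of edges of `G` with one endpoint in `S` and the other in `T`. -/
noncomputable def eBtw {V : Type} (G : SimpleGraph V) (S T : Set V) : ℕ :=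
  {e ∈ G.edgeSet | ∃ a ∈ S, ∃ b ∈ T, e = s(a, b)}.ncard

/-- `G` is `(p, β)`-jumbled. -/
def IsJumbled {V : Type} (G : SimpleGraph V) (p β : ℝ) : Prop :=
  ∀ S : Set V, |(eIn G S : ℝ) - p * ((S.ncard : ℝ) * ((S.ncard : ℝ) - 1) / 2)| ≤ β * S.ncard

/-- `G` is strongly `2`-jumping. -/
def StronglyTwoJumping (n : ℕ) (G : SimpleGraph (Fin n)) : Prop :=
  ∀ T : Set (Fin n), T.Nonempty →
    (∑ v ∈ (Set.toFinite T).toFinset, (deg G v : ℝ)) / (T.ncard : ℝ) ≥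
      (minDeg G : ℝ) + min ((T.ncard : ℝ) - 1) ((Real.log n) ^ 2)

/-- `G` is `p`-pseudorandom. -/
def IsPseudorandom (n : ℕ) (G : SimpleGraph (Fin n)) (p : ℝ) : Prop :=
  IsJumbled G p (2 * Real.sqrt (n * p * (1 - p))) ∧
  (∀ S T : Set (Fin n), Disjoint S T →
    ((1 / (S.ncard : ℝ) + 1 / (T.ncard : ℝ)) * Real.log n / p ≥ 7 / 2 →
      (eBtw G S T : ℝ) ≤ 2 * ((S.ncard : ℝ) + (T.ncard : ℝ)) * Real.log n) ∧
    ((1 / (S.ncard : ℝ) + 1 / (T.ncard : ℝ)) * Real.log n / p ≤ 7 / 2 →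
      (eBtw G S T : ℝ) ≤ 7 * (S.ncard : ℝ) * (T.ncard : ℝ) * p)) ∧
  (∀ S : Set (Fin n),
    (Real.log n / ((S.ncard : ℝ) * p) ≥ 7 / 4 → (eIn G S : ℝ) ≤ 2 * (S.ncard : ℝ) * Real.log n) ∧
    (Real.log n / ((S.ncard : ℝ) * p) ≤ 7 / 4 → (eIn G S : ℝ) ≤ 7 * (S.ncard : ℝ) ^ 2 * p / 2)) ∧
  ((n : ℝ) * p - 2 * Real.sqrt ((n : ℝ) * p * Real.log n) ≤ (minDeg G : ℝ) ∧
    (minDeg G : ℝ) ≤ (n : ℝ) * p - 200 * Real.sqrt ((n : ℝ) * p * (1 - p)) ∧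
    (maxDeg G : ℝ) ≤ (n : ℝ) * p + 2 * Real.sqrt ((n : ℝ) * p * Real.log n)) ∧
  StronglyTwoJumping n G

/-- `G` is `u`-jumping. -/
def IsJumping (n : ℕ) (G : SimpleGraph (Fin n)) (u : ℝ) : Prop :=
  ∃ x₀ : Fin n, deg G x₀ = minDeg G ∧
    ∀ x : Fin n, x ≠ x₀ → (deg G x : ℝ) ≥ (minDeg G : ℝ) + u

/-- `C` is a Hamilton cycle (on the whole vertex set `Fin n`). -/
def IsHamCycle {n : ℕ} (C : SimpleGraph (Fin n)) : Prop :=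
  ∃ (v : Fin n) (w : C.Walk v v), w.IsHamiltonianCycle ∧ C.edgeSet = {e | e ∈ w.edges}

/-- `G` has property `H`. -/
def HasPropertyH (n : ℕ) (G : SimpleGraph (Fin n)) : Prop :=
  ∃ HC : Fin (minDeg G / 2) → SimpleGraph (Fin n),
    (∀ i, HC i ≤ G ∧ IsHamCycle (HC i)) ∧
    (∀ i j, i ≠ j → Disjoint (HC i).edgeSet (HC j).edgeSet) ∧
    (Odd (minDeg G) →
      ∃ M : SimpleGraph (Fin n), M ≤ G ∧ (∀ v, deg M v ≤ 1) ∧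
        M.edgeSet.ncard = n / 2 ∧ ∀ i, Disjoint M.edgeSet (HC i).edgeSet)

/-- Probability of the event `A` under the binomial random graph `G_{n,p}`. -/
noncomputable def gnpProb (n : ℕ) (p : ℝ) (A : SimpleGraph (Fin n) → Prop) : ℝ :=
  ∑ G : SimpleGraph (Fin n),
    if A G then p ^ G.edgeSet.ncard * (1 - p) ^ (n.choose 2 - G.edgeSet.ncard) else 0


/-- Number of cycles of a 2-regular graph = number of connected components. -/
noncomputable def numCycles {V : Type} (F : SimpleGraph V) : ℕ := Nat.card F.ConnectedComponent

/-- `N` is a perfect matching on the whole vertex set. -/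
def IsPerfectMatchingGraph {n : ℕ} (N : SimpleGraph (Fin n)) : Prop :=
  ∀ v, ((N.neighborSet v).ncard) = 1

/-- `N` is a perfect pseudomatching: one vertex of degree 2, all others of degree 1. -/
def IsPerfectPseudomatching {n : ℕ} (N : SimpleGraph (Fin n)) : Prop :=
  ∃ w, ((N.neighborSet w).ncard) = 2 ∧ ∀ v, v ≠ w → ((N.neighborSet v).ncard) = 1

/-- A set of edges forms a matching (no two distinct edges share a vertex). -/
def IsMatchingSet {n : ℕ} (E : Set (Sym2 (Fin n))) : Prop :=
  ∀ e ∈ E, ∀ f ∈ E, e ≠ f → ∀ v : Fin n, v ∈ e → v ∉ f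

/-- Number of cycles (orbits, including fixed points) of a permutation. -/
noncomputable def cycleCount {α : Type} (σ : Equiv.Perm α) : ℕ :=
  Nat.card (Quotient (⟨σ.SameCycle,
    ⟨fun x => Equiv.Perm.SameCycle.refl σ x, fun h => h.symm, fun h h' => h.trans h'⟩⟩ : Setoid α))

/-- Edges of the bipartite graph given by the relation `R` between `S` and `T`. -/
noncomputable def eBip {n : ℕ} (R : Fin n → Fin n → Prop) (S T : Set (Fin n)) : ℕ :=
  {q : Fin n × Fin n | q.1 ∈ S ∧ q.2 ∈ T ∧ R q.1 q.2}.ncard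

/-- One rotation of a path (represented as a list of vertices), with new edge from `H`
and pivot in `Q`. -/
def RotStep {V : Type} (H : SimpleGraph V) (Q : Set V) (l l' : List V) : Prop :=
  ∃ (x : V) (a : List V) (p : V) (b : List V),
    l = (x :: a) ++ p :: b ∧ l' = (x :: a).reverse ++ p :: b ∧ p ∈ Q ∧ H.Adj x p

/-- `v` is `(H, Q, τ)`-reachable from the path `l`. -/
def ReachableVert {V : Type} (H : SimpleGraph V) (Q : Set V) (τ : ℕ) (l : List V) (v : V) : Prop :=
  ∃ (k : ℕ) (f : ℕ → List V), k ≤ τ ∧ f 0 = l ∧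
    (∀ i < k, RotStep H Q (f i) (f (i + 1))) ∧ (f k).head? = some v

/-- External neighbourhood. -/
def extNbhd {V : Type} (H : SimpleGraph V) (S : Set V) : Set V :=
  (⋃ x ∈ S, H.neighborSet x) \ S

end EDHC

namespace EDHC

/-- The weight of a graph under the binomial random graph measure. -/
noncomputable def gnpWeight (n : ℕ) (p : ℝ) (G : SimpleGraph (Fin n)) : ℝ :=
  p ^ G.edgeSet.ncard * (1 - p) ^ (n.choose 2 - G.edgeSet.ncard)

lemma gnpWeight_nonneg {n : ℕ} {p : ℝ} (h0 : 0 ≤ p) (h1 : p ≤ 1) (G : SimpleGraph (Fin n)) :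
    0 ≤ gnpWeight n p G :=
  mul_nonneg (pow_nonneg h0 _) (pow_nonneg (sub_nonneg.2 h1) _)

lemma gnpProb_eq_sum (n : ℕ) (p : ℝ) (P : SimpleGraph (Fin n) → Prop) :
    gnpProb n p P = ∑ G, if P G then gnpWeight n p G else 0 := rfl

/-- The expectation of a product of edge weights factorises over the potential edges. -/
lemma sum_gnpWeight_mul_prod (n : ℕ) (p : ℝ) (w : Sym2 (Fin n) → ℝ) :
    ∑ G : SimpleGraph (Fin n), gnpWeight n p G * ∏ e ∈ G.edgeFinset, w e =
      ∏ e ∈ (⊤ : SimpleGraph (Fin n)).edgeFinset, (p * w e + (1 - p)) := by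
  rw [Finset.prod_add]
  refine Finset.sum_bij' (fun G _ => G.edgeFinset)
    (fun s _ => SimpleGraph.fromEdgeSet (s : Set (Sym2 (Fin n)))) ?_ ?_ ?_ ?_ ?_
  · intro G _
    rw [Finset.mem_powerset]
    exact SimpleGraph.edgeFinset_mono le_top
  · simp
  · intro G _
    simp
  · intro s hs
    rw [Finset.mem_powerset] at hs
    ext e
    have := @hs e
    simp at this
    simpa using this
  · intro G _
    have hsub : G.edgeFinset ⊆ (⊤ : SimpleGraph (Fin n)).edgeFinset :=
      SimpleGraph.edgeFinset_mono le_top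
    have hc : G.edgeSet.ncard = G.edgeFinset.card := by
      rw [← SimpleGraph.coe_edgeFinset, Set.ncard_coe_finset]
    rw [Finset.prod_mul_distrib, Finset.prod_const, Finset.prod_const,
      Finset.card_sdiff_of_subset hsub, SimpleGraph.card_edgeFinset_top_eq_card_choose_two,
      Fintype.card_fin, gnpWeight, hc]
    ring

lemma sum_gnpWeight (n : ℕ) (p : ℝ) : ∑ G, gnpWeight n p G = 1 := by
  simpa using sum_gnpWeight_mul_prod n p (fun _ => 1)

lemma gnpProb_eq_one_sub (n : ℕ) (p : ℝ) (P : SimpleGraph (Fin n) → Prop) :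
    gnpProb n p P = 1 - gnpProb n p (fun G => ¬ P G) := by
  rw [eq_sub_iff_add_eq, ← sum_gnpWeight n p, gnpProb_eq_sum, gnpProb_eq_sum,
    ← Finset.sum_add_distrib]
  refine Finset.sum_congr rfl fun G _ => ?_
  by_cases h : P G <;> simp [h]

lemma gnpProb_le_sum {ι : Type} (t : Finset ι) {n : ℕ} {p : ℝ} (h0 : 0 ≤ p) (h1 : p ≤ 1)
    {P : SimpleGraph (Fin n) → Prop} {Q : ι → SimpleGraph (Fin n) → Prop}
    (h : ∀ G, P G → ∃ i ∈ t, Q i G) :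
    gnpProb n p P ≤ ∑ i ∈ t, gnpProb n p (Q i) := by
  simp only [gnpProb_eq_sum]
  rw [Finset.sum_comm]
  refine Finset.sum_le_sum fun G _ => ?_
  have hw := gnpWeight_nonneg h0 h1 G
  have hn : ∀ i ∈ t, 0 ≤ if Q i G then gnpWeight n p G else 0 := fun i _ => by
    split_ifs
    exacts [hw, le_rfl]
  split_ifs with hP
  · obtain ⟨i, hi, hQ⟩ := h G hP
    exact (if_pos hQ).ge.trans (Finset.single_le_sum hn hi)
  · exact Finset.sum_nonneg hn

/-- The potential edges between two vertex sets. -/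
noncomputable def cutEdges {V : Type} [DecidableEq V] (A B : Finset V) : Finset (Sym2 V) :=
  (A ×ˢ B).image fun q => s(q.1, q.2)

lemma card_cutEdges_le {V : Type} [DecidableEq V] (A B : Finset V) :
    (cutEdges A B).card ≤ A.card * B.card :=
  Finset.card_image_le.trans (Finset.card_product A B).le

lemma eBtw_eq_card {n : ℕ} (G : SimpleGraph (Fin n)) (A B : Finset (Fin n)) :
    eBtw G A B = (G.edgeFinset.filter (· ∈ cutEdges A B)).card := by
  rw [eBtw, ← Set.ncard_coe_finset]
  congr 1
  ext e
  simp [cutEdges, eq_comm, and_assoc]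

lemma eBtw_le {n : ℕ} (G : SimpleGraph (Fin n)) (A B : Finset (Fin n)) :
    eBtw G A B ≤ A.card * B.card := by
  rw [eBtw_eq_card]
  refine le_trans (Finset.card_le_card fun e he => ?_) (card_cutEdges_le A B)
  exact (Finset.mem_filter.1 he).2

/-- Moment generating function bound for the number of edges between two sets. -/
lemma sum_gnpWeight_mul_pow_eBtw_le {n : ℕ} {p r : ℝ} (h0 : 0 ≤ p) (hr : 1 ≤ r)
    (A B : Finset (Fin n)) :
    ∑ G : SimpleGraph (Fin n), gnpWeight n p G * r ^ eBtw G A B ≤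
      Real.exp ((r - 1) * (A.card * B.card * p)) := by
  have hpr : 0 ≤ p * (r - 1) := mul_nonneg h0 (sub_nonneg.2 hr)
  have key := sum_gnpWeight_mul_prod n p (fun e => if e ∈ cutEdges A B then r else 1)
  have hl : ∀ G : SimpleGraph (Fin n),
      ∏ e ∈ G.edgeFinset, (if e ∈ cutEdges A B then r else 1) = r ^ eBtw G A B := fun G => by
    rw [eBtw_eq_card, ← Finset.prod_filter, Finset.prod_const]
  simp only [hl] at key
  rw [key]
  have hterm : ∀ e : Sym2 (Fin n), p * (if e ∈ cutEdges A B then r else 1) + (1 - p) =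
      if e ∈ cutEdges A B then 1 + p * (r - 1) else 1 := fun e => by
    split_ifs <;> ring
  simp only [hterm]
  rw [← Finset.prod_filter, Finset.prod_const]
  have hcard : (((⊤ : SimpleGraph (Fin n)).edgeFinset.filter (· ∈ cutEdges A B)).card : ℝ) ≤
      A.card * B.card := by
    exact_mod_cast (Finset.card_le_card fun e he => (Finset.mem_filter.1 he).2).trans
      (card_cutEdges_le A B)
  calc _ ≤ Real.exp (p * (r - 1)) ^
        ((⊤ : SimpleGraph (Fin n)).edgeFinset.filter (· ∈ cutEdges A B)).card := by
        gcongr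
        linarith [Real.add_one_le_exp (p * (r - 1))]
    _ ≤ _ := by
        rw [← Real.exp_nat_mul]
        refine Real.exp_le_exp.2 ?_
        nlinarith [mul_le_mul_of_nonneg_right hcard hpr]

/-- Chernoff bound for the number of edges between two sets. -/
lemma gnpProb_lt_eBtw_le {n : ℕ} {p r : ℝ} (h0 : 0 ≤ p) (h1 : p ≤ 1) (hr : 1 ≤ r)
    (A B : Finset (Fin n)) (t : ℝ) :
    gnpProb n p (fun G => t < eBtw G A B) ≤
      Real.exp ((r - 1) * (A.card * B.card * p) - t * Real.log r) := by
  have hr0 : 0 < r := by linarith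
  rw [Real.exp_sub, le_div_iff₀ (Real.exp_pos _)]
  refine le_trans ?_ (sum_gnpWeight_mul_pow_eBtw_le h0 hr A B)
  rw [gnpProb_eq_sum, Finset.sum_mul]
  refine Finset.sum_le_sum fun G _ => ?_
  have hw := gnpWeight_nonneg h0 h1 G
  split_ifs with h
  · gcongr
    rw [← Real.exp_log (pow_pos hr0 (eBtw G A B)), Real.log_pow]
    exact Real.exp_le_exp.2 (mul_le_mul_of_nonneg_right h.le (Real.log_nonneg hr))
  · rw [zero_mul]
    positivity

lemma gnpProb_mono {n : ℕ} {p : ℝ} (h0 : 0 ≤ p) (h1 : p ≤ 1)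
    {P Q : SimpleGraph (Fin n) → Prop} (h : ∀ G, P G → Q G) :
    gnpProb n p P ≤ gnpProb n p Q := by
  simpa using gnpProb_le_sum ({()} : Finset Unit) h0 h1 (Q := fun _ => Q)
    (fun G hG => ⟨(), by simp, h G hG⟩)

lemma log_twentyone_div_four_gt : (1.61 : ℝ) < Real.log (21 / 4) := by
  have h : (21 / 4 : ℝ) = 2 * 2 * (21 / 16) := by norm_num
  rw [h, Real.log_mul (by norm_num) (by norm_num), Real.log_mul (by norm_num) (by norm_num)]
  have := Real.one_sub_inv_le_log_of_pos (show (0 : ℝ) < 21 / 16 by norm_num)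
  have := Real.log_two_gt_d9
  norm_num at *
  linarith

lemma log_six_gt : (1.7 : ℝ) < Real.log 6 := by
  have h : (6 : ℝ) = 2 * 2 * (3 / 2) := by norm_num
  rw [h, Real.log_mul (by norm_num) (by norm_num), Real.log_mul (by norm_num) (by norm_num)]
  have := Real.one_sub_inv_le_log_of_pos (show (0 : ℝ) < 3 / 2 by norm_num)
  have := Real.log_two_gt_d9
  norm_num at *
  linarith

/-- The edge-count bounds of `stmt_4` for a single pair of sets of sizes `a` and `b`
spanning `x` edges, with `l` in place of `log n`. -/
def EdgeCountBound (a b l p x : ℝ) : Prop :=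
  ((1 / a + 1 / b) * l / p ≥ 7 / 2 → x ≤ 3 / 2 * (a + b) * l) ∧
    ((1 / a + 1 / b) * l / p ≤ 7 / 2 → x ≤ 6 * a * b * p)

lemma inv_add_inv_mul_div_eq {a b l p : ℝ} (ha : 0 < a) (hb : 0 < b) (hp : 0 < p) :
    (1 / a + 1 / b) * l / p = (a + b) * l / (a * b * p) := by
  field_simp
  ring

lemma gnpProb_not_edgeCountBound_le {n : ℕ} {p l : ℝ} (h0 : 0 < p) (h1 : p ≤ 1) (hl : 0 ≤ l)
    (A B : Finset (Fin n)) :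
    gnpProb n p (fun G => ¬ EdgeCountBound A.card B.card l p (eBtw G A B)) ≤
      Real.exp (-l) ^ A.card * Real.exp (-l) ^ B.card * Real.exp (-(1.2 * l ^ 2)) := by
  have hrhs : Real.exp (-l) ^ A.card * Real.exp (-l) ^ B.card * Real.exp (-(1.2 * l ^ 2)) =
      Real.exp (-((A.card + B.card) * l) - 1.2 * l ^ 2) := by
    rw [← Real.exp_nat_mul, ← Real.exp_nat_mul, ← Real.exp_add, ← Real.exp_add]
    ring_nf
  rw [hrhs]
  have hX : ∀ G : SimpleGraph (Fin n), (eBtw G A B : ℝ) ≤ A.card * B.card := fun G => by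
    exact_mod_cast eBtw_le G A B
  have hX0 : ∀ G : SimpleGraph (Fin n), (0 : ℝ) ≤ eBtw G A B := fun G => Nat.cast_nonneg _
  have ha : (0 : ℝ) ≤ A.card := Nat.cast_nonneg _
  have hb : (0 : ℝ) ≤ B.card := Nat.cast_nonneg _
  generalize hae : (A.card : ℝ) = a at *
  generalize hbe : (B.card : ℝ) = b at *
  by_cases hnone : ∀ G : SimpleGraph (Fin n), EdgeCountBound a b l p (eBtw G A B)
  · simp only [gnpProb, hnone, not_true, if_false, Finset.sum_const_zero]
    positivity
  push Not at hnone
  obtain ⟨G₀, hG₀⟩ := hnone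
  have hab : 0 < a * b := by
    by_contra hab
    have hab0 : a * b = 0 := le_antisymm (not_lt.1 hab) (mul_nonneg ha hb)
    have hx : (eBtw G₀ A B : ℝ) = 0 := le_antisymm (hab0 ▸ hX G₀) (hX0 G₀)
    refine hG₀ ⟨fun _ => ?_, fun _ => ?_⟩ <;> rw [hx]
    · positivity
    · positivity
  have ha' : 0 < a := pos_of_mul_pos_left hab hb
  have hb' : 0 < b := pos_of_mul_pos_right hab ha
  have hμ : 0 < a * b * p := mul_pos hab h0
  have hi : (1 / a + 1 / b) * l / p ≥ 7 / 2 ↔ 7 / 2 * (a * b * p) ≤ (a + b) * l := by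
    rw [inv_add_inv_mul_div_eq ha' hb' h0, ge_iff_le, le_div_iff₀ hμ]
  have hii : (1 / a + 1 / b) * l / p ≤ 7 / 2 ↔ (a + b) * l ≤ 7 / 2 * (a * b * p) := by
    rw [inv_add_inv_mul_div_eq ha' hb' h0, div_le_iff₀ hμ]
  simp only [EdgeCountBound, hi, hii] at hG₀ ⊢
  have hs : 6 * l ≤ a + b → 6 * l ^ 2 ≤ (a + b) * l := fun h => by nlinarith
  have hamgm : 4 * (a * b) ≤ (a + b) * (a + b) := by nlinarith [sq_nonneg (a - b)]
  rcases le_or_gt (7 / 2 * (a * b * p)) ((a + b) * l) with hc | hc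
  · have himp : ∀ G : SimpleGraph (Fin n),
        ¬ ((7 / 2 * (a * b * p) ≤ (a + b) * l → (eBtw G A B : ℝ) ≤ 3 / 2 * (a + b) * l) ∧
          ((a + b) * l ≤ 7 / 2 * (a * b * p) → (eBtw G A B : ℝ) ≤ 6 * a * b * p)) →
        3 / 2 * (a + b) * l < eBtw G A B := fun G h => by
      by_contra! hx
      exact h ⟨fun _ => hx, fun h' => by linarith⟩
    have hlarge : 6 * l ≤ a + b := by
      have := (himp G₀ hG₀).trans_le (hX G₀)
      by_contra! hlt
      nlinarith [mul_lt_mul_of_pos_left hlt (add_pos ha' hb')]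
    refine (gnpProb_mono h0.le h1 himp).trans
      ((gnpProb_lt_eBtw_le h0.le h1 (r := 21 / 4) (by norm_num) A B _).trans
        (Real.exp_le_exp.2 ?_))
    rw [hae, hbe]
    have hsl : 0 ≤ (a + b) * l := by positivity
    nlinarith [mul_le_mul_of_nonneg_left log_twentyone_div_four_gt.le hsl, hs hlarge]
  · have himp : ∀ G : SimpleGraph (Fin n),
        ¬ ((7 / 2 * (a * b * p) ≤ (a + b) * l → (eBtw G A B : ℝ) ≤ 3 / 2 * (a + b) * l) ∧
          ((a + b) * l ≤ 7 / 2 * (a * b * p) → (eBtw G A B : ℝ) ≤ 6 * a * b * p)) →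
        6 * a * b * p < eBtw G A B := fun G h => by
      by_contra! hx
      exact h ⟨fun h' => absurd h' hc.not_ge, fun _ => hx⟩
    have hlarge : 6 * l ≤ a + b := by
      have := (himp G₀ hG₀).trans_le (hX G₀)
      by_contra! hlt
      nlinarith [mul_lt_mul_of_pos_left hlt (add_pos ha' hb')]
    refine (gnpProb_mono h0.le h1 himp).trans
      ((gnpProb_lt_eBtw_le h0.le h1 (r := 6) (by norm_num) A B _).trans
        (Real.exp_le_exp.2 ?_))
    rw [hae, hbe]
    nlinarith [mul_le_mul_of_nonneg_left log_six_gt.le hμ.le, hs hlarge]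

lemma sum_pow_card_le {n : ℕ} (hn : 0 < n) :
    ∑ A : Finset (Fin n), Real.exp (-Real.log n) ^ A.card ≤ Real.exp 1 := by
  have hn' : (0 : ℝ) < n := Nat.cast_pos.2 hn
  have h := Fintype.sum_pow_mul_eq_add_pow (Fin n) (Real.exp (-Real.log n)) 1
  simp only [one_pow, mul_one, Fintype.card_fin] at h
  rw [h]
  calc _ ≤ Real.exp (Real.exp (-Real.log n)) ^ n := by
        gcongr
        exact Real.add_one_le_exp _
    _ = _ := by
        rw [← Real.exp_nat_mul, Real.exp_neg, Real.exp_log hn', mul_inv_cancel₀ hn'.ne']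

end EDHC

open EDHC in
/-- Lemma 4.3: edge counts between disjoint sets in `G_{n,p}`. -/
theorem stmt_4 :
    ∃ N : ℕ, ∀ n : ℕ, N ≤ n → ∀ p : ℝ, 0 < p → p ≤ 1 →
      1 - 1 / (n : ℝ) ^ 2 ≤ gnpProb n p (fun G =>
        ∀ A B : Set (Fin n), Disjoint A B →
          ((1 / (A.ncard : ℝ) + 1 / (B.ncard : ℝ)) * Real.log n / p ≥ 7 / 2 →
            (eBtw G A B : ℝ) ≤ 3 / 2 * ((A.ncard : ℝ) + (B.ncard : ℝ)) * Real.log n) ∧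
          ((1 / (A.ncard : ℝ) + 1 / (B.ncard : ℝ)) * Real.log n / p ≤ 7 / 2 →
            (eBtw G A B : ℝ) ≤ 6 * (A.ncard : ℝ) * (B.ncard : ℝ) * p)) := by
  refine ⟨⌈Real.exp 3⌉₊, fun n hn p h0 h1 => ?_⟩
  have hn3 : Real.exp 3 ≤ n := Nat.ceil_le.1 hn
  have hn' : (0 : ℝ) < n := (Real.exp_pos 3).trans_le hn3
  have hl : 3 ≤ Real.log n := (Real.le_log_iff_exp_le hn').2 hn3
  rw [gnpProb_eq_one_sub]
  refine sub_le_sub_left ?_ 1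
  calc _ ≤ ∑ q ∈ (Finset.univ : Finset (Finset (Fin n) × Finset (Fin n))),
        gnpProb n p (fun G => ¬ EdgeCountBound q.1.card q.2.card (Real.log n) p
          (eBtw G q.1 q.2)) := by
        refine gnpProb_le_sum _ h0.le h1 fun G hG => ?_
        push Not at hG
        obtain ⟨A, B, -, hAB⟩ := hG
        refine ⟨(A.toFinset, B.toFinset), Finset.mem_univ _, fun h => ?_⟩
        simp only [EdgeCountBound, Set.coe_toFinset, ← Set.ncard_eq_toFinset_card'] at h
        exact absurd (hAB h.1) (by simpa using h.2)
    _ ≤ ∑ q : Finset (Fin n) × Finset (Fin n), Real.exp (-Real.log n) ^ q.1.card *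
          Real.exp (-Real.log n) ^ q.2.card * Real.exp (-(1.2 * Real.log n ^ 2)) :=
        Finset.sum_le_sum fun q _ =>
          gnpProb_not_edgeCountBound_le h0 h1 (by linarith) q.1 q.2
    _ = (∑ A : Finset (Fin n), Real.exp (-Real.log n) ^ A.card) *
          (∑ B : Finset (Fin n), Real.exp (-Real.log n) ^ B.card) *
          Real.exp (-(1.2 * Real.log n ^ 2)) := by
        rw [← Finset.sum_mul, Finset.sum_mul_sum, Fintype.sum_prod_type]
    _ ≤ Real.exp 1 * Real.exp 1 * Real.exp (-(1.2 * Real.log n ^ 2)) := by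
        have hsum := sum_pow_card_le (Nat.cast_pos.1 hn')
        gcongr
    _ ≤ Real.exp (-(2 * Real.log n)) := by
        rw [← Real.exp_add, ← Real.exp_add]
        refine Real.exp_le_exp.2 ?_
        nlinarith
    _ = 1 / (n : ℝ) ^ 2 := by
        rw [Real.exp_neg, two_mul, Real.exp_add, Real.exp_log hn', one_div, sq]
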